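/- arXiv:2403.01951 — 2 statements merged into one kernel-verified Lean document; each statement's English description precedes it below -/
import Mathlib

section
/- Let X be a nonempty compact Hausdorff topological space, let Y be an irreducible topological space admitting a basis of quasi-compact open subsets, and let f : X → Y be a continuous map with dense image such that f⁻¹(U) is compact for every quasi-compact open subset U ⊆ Y. Then there exists a point x ∈ X such that the singleton {f(x)} is dense in Y; in particular, if Y is sober then the generic point of Y lies in the image of f. -/
/-- Let `X` be a nonempty compact Hausdorff space, `Y` an irreducible space with a basis
of quasi-compact open sets, and `f : X → Y` a continuous map with dense image such that
the preimage of every quasi-compact open set is compact.  Then some point of `X` maps to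
a point whose closure is all of `Y` (a generic point). -/
theorem exists_dense_singleton_image
    {X Y : Type*} [TopologicalSpace X] [TopologicalSpace Y]
    [Nonempty X] [CompactSpace X] [T2Space X] [IrreducibleSpace Y]
    {B : Set (Set Y)} (hB : TopologicalSpace.IsTopologicalBasis B)
    (hBc : ∀ U ∈ B, IsCompact U)
    (f : X → Y) (hf : Continuous f) (hdense : DenseRange f)
    (hcpt : ∀ U : Set Y, IsOpen U → IsCompact U → IsCompact (f ⁻¹' U)) :
    ∃ x : X, Dense ({f x} : Set Y) := by
  let ι := {W : Set Y // W ∈ B ∧ W.Nonempty}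
  have : Nonempty ι := by
    obtain ⟨W, hW, hxW, -⟩ :=
      hB.exists_subset_of_mem_open (Set.mem_univ (f (Classical.arbitrary X))) isOpen_univ
    exact ⟨⟨W, hW, _, hxW⟩⟩
  have hc (W : ι) : IsCompact (f ⁻¹' W.1) := hcpt _ (hB.isOpen W.2.1) (hBc _ W.2.1)
  have hdir : Directed (· ⊇ ·) fun W : ι => f ⁻¹' W.1 := by
    intro V W
    obtain ⟨y, hy⟩ := nonempty_preirreducible_inter (hB.isOpen V.2.1) (hB.isOpen W.2.1) V.2.2 W.2.2
    obtain ⟨T, hT, hyT, hTVW⟩ :=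
      hB.exists_subset_of_mem_open hy ((hB.isOpen V.2.1).inter (hB.isOpen W.2.1))
    exact ⟨⟨T, hT, y, hyT⟩, fun _ hz => (hTVW hz).1, fun _ hz => (hTVW hz).2⟩
  obtain ⟨x, hx⟩ := IsCompact.nonempty_iInter_of_directed_nonempty_isCompact_isClosed
    (fun W : ι => f ⁻¹' W.1) hdir
    (fun W => hdense.exists_mem_open (hB.isOpen W.2.1) W.2.2) hc fun W => (hc W).isClosed
  exact ⟨x, hB.dense_iff.2 fun W hW hne => ⟨f x, Set.mem_iInter.1 hx ⟨W, hW, hne⟩, rfl⟩⟩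
end

section
/- Let V be a valuation ring with fraction field F and residue field κ, let d ≥ 0 be an integer, and let Z be an integral scheme together with a proper dominant morphism f : Z → Spec V such that the function field of Z has transcendence degree at most d over F. Then the generic fiber Z ×_{Spec V} Spec F and the special fiber Z ×_{Spec V} Spec κ both have Krull dimension at most d. -/
open AlgebraicGeometry CategoryTheory Limits

universe u

open TopologicalSpace TensorProduct

lemma Algebra.IsIntegral.ringKrullDim_le (R S : Type*) [CommRing R] [CommRing S] [Algebra R S]
    [Algebra.IsIntegral R S] : ringKrullDim S ≤ ringKrullDim R :=
  Order.krullDim_le_of_strictMono (PrimeSpectrum.comap (algebraMap R S)) fun _ _ h ↦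
    Ideal.IsIntegral.comap_lt_comap h

lemma ringKrullDim_le_of_forall_algebraicIndependent_le (k B : Type*) [Field k] [CommRing B]
    [Algebra k B] [Algebra.FiniteType k B] (d : ℕ)
    (h : ∀ (n : ℕ) (b : Fin n → B), AlgebraicIndependent k b → n ≤ d) :
    ringKrullDim B ≤ d := by
  nontriviality B
  obtain ⟨s, g, hg, hint⟩ := exists_integral_inj_algHom_of_fg k B
  have hs : s ≤ d := h s (g ∘ MvPolynomial.X) <| (MvPolynomial.algebraicIndependent_X _ _).map' hg
  algebraize [g.toRingHom]
  have : Algebra.IsIntegral (MvPolynomial (Fin s) k) B := ⟨hint⟩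
  calc
    _ ≤ ringKrullDim (MvPolynomial (Fin s) k) := Algebra.IsIntegral.ringKrullDim_le _ _
    _ = s := by simp [MvPolynomial.ringKrullDim_of_isNoetherianRing]
    _ ≤ d := by exact_mod_cast hs

/-- Over a valuation ring, a nonzero polynomial is a multiple of one with a unit coefficient. -/
lemma MvPolynomial.exists_eq_smul_coeff_eq_one {V σ : Type*} [CommRing V] [IsDomain V]
    [ValuationRing V] {p : MvPolynomial σ V} (hp : p ≠ 0) :
    ∃ (c : V) (q : MvPolynomial σ V) (m : σ →₀ ℕ), c ≠ 0 ∧ p = c • q ∧ q.coeff m = 1 := by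
  obtain ⟨m, hm, hmin⟩ : ∃ m ∈ p.support, ∀ n ∈ p.support, p.coeff m ∣ p.coeff n := by
    have key : ∀ s : Finset (σ →₀ ℕ), s.Nonempty → ∃ m ∈ s, ∀ n ∈ s, p.coeff m ∣ p.coeff n := by
      intro s hs
      induction hs using Finset.Nonempty.cons_induction with
      | singleton a => simp
      | cons a s ha hs ih =>
        obtain ⟨m, hm, h⟩ := ih
        rcases ValuationRing.dvd_total (p.coeff a) (p.coeff m) with h' | h'
        · exact ⟨a, by simp, by simpa using fun n hn ↦ h'.trans (h n hn)⟩
        · exact ⟨m, by simp [hm], by simpa [h'] using h⟩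
    exact key _ (by simpa using hp)
  have hc : p.coeff m ≠ 0 := MvPolynomial.mem_support_iff.mp hm
  obtain ⟨q, hq⟩ : C (p.coeff m) ∣ p := by
    rw [MvPolynomial.C_dvd_iff_dvd_coeff]
    intro n
    by_cases hn : n ∈ p.support
    · exact hmin n hn
    · simp [MvPolynomial.notMem_support_iff.mp hn]
  refine ⟨p.coeff m, q, m, hc, by rw [smul_eq_C_mul, ← hq], ?_⟩
  have := congr(coeff m $hq)
  rw [coeff_C_mul] at this
  exact mul_left_cancel₀ hc (by rw [← this, mul_one])

/-- Over a valuation ring, a family whose image in an algebra over the residue field is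
algebraically independent over that field is itself algebraically independent. -/
lemma AlgebraicIndependent.of_residue {V A B ι : Type*} [CommRing V] [IsDomain V]
    [ValuationRing V] [CommRing A] [Algebra V A] [Module.IsTorsionFree V A]
    [CommRing B] [Algebra V B] [Algebra (IsLocalRing.ResidueField V) B]
    [IsScalarTower V (IsLocalRing.ResidueField V) B] (φ : A →ₐ[V] B) {a : ι → A}
    (h : AlgebraicIndependent (IsLocalRing.ResidueField V) (φ ∘ a)) :
    AlgebraicIndependent V a := by
  rw [algebraicIndependent_iff] at h ⊢
  intro p hp
  by_contra hp0
  obtain ⟨c, q, m, hc, rfl, hm⟩ := MvPolynomial.exists_eq_smul_coeff_eq_one hp0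
  rw [map_smul, smul_eq_zero_iff_right hc] at hp
  have := h (MvPolynomial.map (algebraMap V _) q) (by
    rw [MvPolynomial.aeval_map_algebraMap]
    exact (MvPolynomial.comp_aeval_apply (φ := φ) a q).symm.trans (by rw [hp, map_zero]))
  have := congr(MvPolynomial.coeff m $this)
  simp [MvPolynomial.coeff_map, hm] at this

lemma AlgebraicIndependent.le_of_forall_finset_card_le {F K : Type*} [Field F] [Field K]
    [Algebra F K] {d : ℕ}
    (h : ∀ s : Finset K, AlgebraicIndependent F (fun x : (s : Set K) => (x : K)) → s.card ≤ d)
    {n : ℕ} {b : Fin n → K} (hb : AlgebraicIndependent F b) : n ≤ d := by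
  classical
  have hs : ((Finset.univ.image b : Finset K) : Set K) = Set.range b := by simp
  have := h (Finset.univ.image b) (by rw [hs]; exact hb.coe_range)
  rwa [Finset.card_image_of_injective _ hb.injective, Finset.card_fin] at this

section Algebra

variable {V : Type*} [CommRing V] [IsDomain V] {d : ℕ}
  {K : Type*} [Field K] [Algebra (FractionRing V) K] [Algebra V K]
  [IsScalarTower V (FractionRing V) K]
  {A : Type*} [CommRing A] [Algebra V A] [Algebra.FiniteType V A]

lemma ringKrullDim_fractionRing_tensorProduct_le
    (htrdeg : ∀ s : Finset K,
      AlgebraicIndependent (FractionRing V) (fun x : (s : Set K) => (x : K)) → s.card ≤ d)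
    (φ : A →ₐ[V] K) (hφ : Function.Injective φ) :
    ringKrullDim (FractionRing V ⊗[V] A) ≤ d := by
  refine ringKrullDim_le_of_forall_algebraicIndependent_le (FractionRing V) _ d fun n b hb ↦ ?_
  let ψ : FractionRing V ⊗[V] A →ₐ[FractionRing V] K :=
    Algebra.TensorProduct.lift (Algebra.ofId _ _) φ fun _ _ ↦ Commute.all _ _
  have hψ : Function.Injective ψ := by
    have key (z : FractionRing V ⊗[V] A) : ∃ (s : V) (a : A), s ≠ 0 ∧ s • z = 1 ⊗ₜ a := by
      induction z with
      | zero => exact ⟨1, 0, one_ne_zero, by simp⟩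
      | tmul x a =>
        obtain ⟨r, s, hs, rfl⟩ := IsFractionRing.div_surjective (A := V) x
        refine ⟨s, r • a, nonZeroDivisors.ne_zero hs, ?_⟩
        have : algebraMap V (FractionRing V) s ≠ 0 := by simpa using nonZeroDivisors.ne_zero hs
        rw [← TensorProduct.smul_tmul, TensorProduct.smul_tmul', Algebra.smul_def,
          Algebra.smul_def, mul_one, mul_div_cancel₀ _ this]
      | add x y hx hy =>
        obtain ⟨s, a, hs, ha⟩ := hx
        obtain ⟨t, b, ht, hb⟩ := hy
        refine ⟨s * t, t • a + s • b, mul_ne_zero hs ht, ?_⟩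
        rw [smul_add, TensorProduct.tmul_add, TensorProduct.tmul_smul, TensorProduct.tmul_smul,
          ← ha, ← hb, mul_comm, mul_smul, mul_comm, mul_smul]
    rw [injective_iff_map_eq_zero]
    intro z hz
    obtain ⟨s, a, hs, ha⟩ := key z
    have h0 : φ a = 0 := by
      have : ψ (s • z) = ψ (1 ⊗ₜ a) := by rw [ha]
      have h2 : ψ (s • z) = s • ψ z := map_smul (ψ.restrictScalars V) s z
      rw [h2, hz, smul_zero] at this
      simpa [ψ] using this.symm
    rw [(map_eq_zero_iff φ hφ).mp h0, TensorProduct.tmul_zero,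
      ← algebraMap_smul (FractionRing V)] at ha
    exact (IsUnit.mk0 (algebraMap V (FractionRing V) s) (by simpa using hs)).smul_eq_zero.mp ha
  exact (hb.map' hψ).le_of_forall_finset_card_le htrdeg

lemma ringKrullDim_residueField_tensorProduct_le [ValuationRing V]
    (htrdeg : ∀ s : Finset K,
      AlgebraicIndependent (FractionRing V) (fun x : (s : Set K) => (x : K)) → s.card ≤ d)
    (φ : A →ₐ[V] K) (hφ : Function.Injective φ) :
    ringKrullDim (IsLocalRing.ResidueField V ⊗[V] A) ≤ d := by
  refine ringKrullDim_le_of_forall_algebraicIndependent_le (IsLocalRing.ResidueField V) _ d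
    fun n b hb ↦ ?_
  have hsurj : Function.Surjective (Algebra.TensorProduct.includeRight :
      A →ₐ[V] IsLocalRing.ResidueField V ⊗[V] A) :=
    Algebra.TensorProduct.includeRight_surjective _ IsLocalRing.residue_surjective
  choose a ha using fun i ↦ hsurj (b i)
  obtain rfl : b = Algebra.TensorProduct.includeRight ∘ a := funext fun i ↦ (ha i).symm
  have : Module.IsTorsionFree V K := .trans_faithfulSMul V (FractionRing V) K
  have : Module.IsTorsionFree V A := hφ.moduleIsTorsionFree φ (by simp)
  have : Algebra.IsAlgebraic V (FractionRing V) :=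
    IsLocalization.isAlgebraic (FractionRing V) (nonZeroDivisors V)
  exact ((hb.of_residue.map' hφ).extendScalars (FractionRing V)).le_of_forall_finset_card_le htrdeg

end Algebra

lemma topologicalKrullDim_le_of_openCover {X : Scheme.{u}} (𝒰 : X.OpenCover) {n : WithBot ℕ∞}
    (h : ∀ i, Nonempty (𝒰.X i) → topologicalKrullDim (𝒰.X i) ≤ n) : topologicalKrullDim X ≤ n := by
  rw [topologicalKrullDim, Order.krullDim_eq_iSup_coheight]
  refine iSup_le fun T ↦ ?_
  obtain ⟨x, hx⟩ := T.2.nonempty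
  obtain ⟨i, y, rfl⟩ := 𝒰.exists_eq x
  obtain ⟨S, hS⟩ := (IrreducibleCloseds.orderIsoOfIsOpenEmbedding (𝒰.f i)
    (𝒰.f i).isOpenEmbedding).surjective ⟨T, y, hx⟩
  obtain rfl : IrreducibleCloseds.map _ (𝒰.f i).continuous S = T := congr($(hS).1)
  rw [(𝒰.f i).isOpenEmbedding.coheight_map]
  exact (Order.coheight_le_krullDim S).trans (h i ⟨y⟩)

lemma topologicalKrullDim_pullback_Spec_le {V : Type u} [CommRing V] {d : ℕ} {R : CommRingCat.{u}}
    [IsReduced (Spec R)] (f : Spec R ⟶ Spec (.of V)) [LocallyOfFiniteType f]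
    {K : Type u} [Field K] [Algebra V K] (g : Spec (.of K) ⟶ Spec R) [IsDominant g]
    (hcomp : g ≫ f = Spec.map (CommRingCat.ofHom (algebraMap V K)))
    (k : Type u) [CommRing k] [Algebra V k]
    (hk : ∀ (A : Type u) [CommRing A] [Algebra V A] [Algebra.FiniteType V A] (φ : A →ₐ[V] K),
      Function.Injective φ → ringKrullDim (k ⊗[V] A) ≤ d) :
    topologicalKrullDim ↥(pullback f (Spec.map (CommRingCat.ofHom (algebraMap V k)))) ≤ d := by
  obtain ⟨ψ, rfl⟩ := Spec.map_surjective f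
  obtain ⟨φ, rfl⟩ := Spec.map_surjective g
  have hft : ψ.hom.FiniteType := HasRingHomProperty.Spec_iff.mp ‹LocallyOfFiniteType (Spec.map ψ)›
  algebraize [ψ.hom]
  have hR : _root_.IsReduced R := (affine_isReduced_iff R).mp ‹_›
  rw [← Spec.map_comp, Spec.map_injective.eq_iff] at hcomp
  let φ' : R →ₐ[V] K := { φ.hom with commutes' := fun v ↦ congr($(hcomp).hom v) }
  have hφ : Function.Injective φ.hom := by
    have := (PrimeSpectrum.denseRange_comap_iff_ker_le_nilRadical φ.hom).mp (Spec.map φ).denseRange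
    rwa [nilradical_eq_zero, Ideal.zero_eq_bot, le_bot_iff, ← RingHom.injective_iff_ker_eq_bot]
      at this
  have e := (pullbackSpecIso V R k).hom.homeomorph
  calc
    _ = topologicalKrullDim (PrimeSpectrum (R ⊗[V] k)) := e.isHomeomorph.topologicalKrullDim_eq
    _ = ringKrullDim (R ⊗[V] k) := PrimeSpectrum.topologicalKrullDim_eq_ringKrullDim _
    _ = ringKrullDim (k ⊗[V] R) :=
      ringKrullDim_eq_of_ringEquiv (Algebra.TensorProduct.comm V R k).toRingEquiv
    _ ≤ d := hk R φ' hφ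

lemma topologicalKrullDim_pullback_le {V : Type u} [CommRing V] {d : ℕ} {Z : Scheme.{u}}
    [IsReduced Z] (f : Z ⟶ Spec (.of V)) [LocallyOfFiniteType f]
    {K : Type u} [Field K] [Algebra V K] (g : Spec (.of K) ⟶ Z) [IsDominant g]
    (hcomp : g ≫ f = Spec.map (CommRingCat.ofHom (algebraMap V K)))
    (k : Type u) [CommRing k] [Algebra V k]
    (hk : ∀ (A : Type u) [CommRing A] [Algebra V A] [Algebra.FiniteType V A] (φ : A →ₐ[V] K),
      Function.Injective φ → ringKrullDim (k ⊗[V] A) ≤ d) :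
    topologicalKrullDim ↥(pullback f (Spec.map (CommRingCat.ofHom (algebraMap V k)))) ≤ d := by
  refine topologicalKrullDim_le_of_openCover
    (Scheme.Pullback.openCoverOfLeft Z.affineOpenCover.openCover _ _) fun i ⟨y⟩ ↦ ?_
  let j : Spec (Z.affineOpenCover.X i) ⟶ Z := Z.affineOpenCover.f i
  have : IsOpenImmersion j := Z.affineOpenCover.openCover.map_prop i
  let p := pullback.fst (j ≫ f) (Spec.map (CommRingCat.ofHom (algebraMap V k)))
  obtain ⟨x, hx⟩ := g.denseRange.exists_mem_open j.isOpenEmbedding.isOpen_range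
    ⟨_, p y, rfl⟩
  have hrange : Set.range g ⊆ Set.range j := by
    rintro _ ⟨x', rfl⟩
    rwa [Subsingleton.elim x' x]
  let g' := IsOpenImmersion.lift j g hrange
  have hg' : g' ≫ j = g := IsOpenImmersion.lift_fac j g hrange
  have : IsDominant (g' ≫ j) := hg' ▸ ‹IsDominant g›
  have : IsDominant g' := .of_comp_of_isOpenImmersion g' j
  have : IsReduced (Spec (Z.affineOpenCover.X i)) := isReduced_of_isOpenImmersion j
  exact topologicalKrullDim_pullback_Spec_le (j ≫ f) g'
    (by rw [← hcomp, ← hg', Category.assoc]) k hk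

/-- Let `V` be a valuation ring with fraction field `F` and residue field `κ`, and let
`Z` be an integral scheme with a proper dominant morphism `f : Z ⟶ Spec V` whose function
field has transcendence degree at most `d` over `F` (witnessed by a dominant morphism
`Spec K ⟶ Z` over `Spec V` from the spectrum of a field `K` with `trdeg_F K ≤ d`,
the transcendence degree bound being expressed by the condition that every finite
algebraically independent subset of `K` over `F` has at most `d` elements).
Then the generic fiber `Z ×_{Spec V} Spec F` and the special fiber `Z ×_{Spec V} Spec κ`
both have Krull dimension at most `d`. -/
theorem fiber_dim_le_of_proper_dominant_trdeg_le
    (V : Type u) [CommRing V] [IsDomain V] [ValuationRing V]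
    (d : ℕ) (Z : Scheme.{u}) [IsIntegral Z]
    (f : Z ⟶ Spec (CommRingCat.of V)) [IsProper f] (hdom : DenseRange f.base)
    (K : Type u) [Field K] [Algebra (FractionRing V) K] [Algebra V K]
    [IsScalarTower V (FractionRing V) K]
    (htrdeg : ∀ s : Finset K,
      AlgebraicIndependent (FractionRing V) (fun x : (s : Set K) => (x : K)) → s.card ≤ d)
    (g : Spec (CommRingCat.of K) ⟶ Z) (hg : DenseRange g.base)
    (hcomp : g ≫ f = Spec.map (CommRingCat.ofHom (algebraMap V K))) :
    topologicalKrullDim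
        (↥(pullback f (Spec.map (CommRingCat.ofHom (algebraMap V (FractionRing V))))))
      ≤ (d : WithBot ℕ∞) ∧
    topologicalKrullDim
        (↥(pullback f (Spec.map (CommRingCat.ofHom (IsLocalRing.residue V)))))
      ≤ (d : WithBot ℕ∞) := by
  have : IsDominant g := ⟨hg⟩
  exact ⟨topologicalKrullDim_pullback_le f g hcomp (FractionRing V) fun _ _ _ _ φ hφ ↦
      ringKrullDim_fractionRing_tensorProduct_le htrdeg φ hφ,
    topologicalKrullDim_pullback_le f g hcomp (IsLocalRing.ResidueField V) fun _ _ _ _ φ hφ ↦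
      ringKrullDim_residueField_tensorProduct_le htrdeg φ hφ⟩
end
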